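/- arXiv:2510.20163 — 3 statements merged into one kernel-verified Lean document; each statement's English description precedes it below -/
import Mathlib

section
/- (Johnson–Lindenstrauss) Let n ≥ 2 and p ≥ 1 be integers, let x_1, …, x_n ∈ ℝ^p, and let ε, δ ∈ (0,1). Suppose m ≥ 1 is an integer satisfying n(n−1)·exp(−m ε²/8) ≤ δ. Then there exists a linear map F : ℝ^p → ℝ^m such that for all indices i, j with x_i ≠ x_j, (1−ε)·‖x_i − x_j‖² ≤ ‖F(x_i) − F(x_j)‖² ≤ (1+ε)·‖x_i − x_j‖². -/
open MeasureTheory ProbabilityTheory Matrix Filter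
open scoped ProbabilityTheory ENNReal

lemma jl_gauss (t : ℝ) (ht : t < 1/2) :
    Integrable (fun z : ℝ => Real.exp (t * z^2)) (gaussianReal 0 1) ∧
    ∫ z, Real.exp (t * z^2) ∂(gaussianReal 0 1) = (√(1 - 2*t))⁻¹ := by
  have key : ∀ z : ℝ, gaussianPDFReal 0 1 z * Real.exp (t * z^2)
      = (√(2 * Real.pi))⁻¹ * Real.exp (-(1/2 - t) * z^2) := by
    intro z
    simp only [gaussianPDFReal, NNReal.coe_one, mul_one, sub_zero]
    rw [mul_assoc, ← Real.exp_add]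
    congr 2; ring
  constructor
  · rw [gaussianReal_of_var_ne_zero _ one_ne_zero,
      integrable_withDensity_iff_integrable_smul' (by fun_prop) (by simp [gaussianPDF])]
    simp only [toReal_gaussianPDF, smul_eq_mul, key]
    exact (integrable_exp_neg_mul_sq (by linarith)).const_mul _
  · rw [integral_gaussianReal_eq_integral_smul one_ne_zero]
    simp only [smul_eq_mul, key]
    rw [integral_const_mul, integral_gaussian, ← Real.sqrt_inv, ← Real.sqrt_inv,
      ← Real.sqrt_mul (by positivity)]
    congr 1
    have : 1 - 2*t ≠ 0 := by linarith
    have : 1/2 - t ≠ 0 := by linarith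
    field_simp

lemma jl_mgf (p m : ℕ) (u : EuclideanSpace ℝ (Fin p)) (hu : ‖u‖ = 1) (t : ℝ) (ht : t < 1/2) :
    Integrable (fun ω : Fin m → EuclideanSpace ℝ (Fin p) =>
      Real.exp (t * ∑ k, (inner ℝ u (ω k))^2)) (Measure.pi fun _ => stdGaussian _) ∧
    ∫ ω : Fin m → EuclideanSpace ℝ (Fin p), Real.exp (t * ∑ k, (inner ℝ u (ω k))^2)
      ∂(Measure.pi fun _ => stdGaussian _) = ((√(1 - 2*t))⁻¹)^m := by
  obtain ⟨h1, h2⟩ := jl_gauss t ht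
  have hmap : (stdGaussian (EuclideanSpace ℝ (Fin p))).map (innerSL ℝ u) = gaussianReal 0 1 := by
    rw [IsGaussian.map_eq_gaussianReal, integral_strongDual_stdGaussian,
      variance_dual_stdGaussian, innerSL_apply_norm, hu]
    simp
  have hm : AEMeasurable (innerSL ℝ u) (stdGaussian (EuclideanSpace ℝ (Fin p))) := by fun_prop
  rw [← hmap] at h1 h2
  rw [integral_map hm (by fun_prop)] at h2
  rw [integrable_map_measure (by fun_prop) hm] at h1
  simp only [innerSL_apply_apply] at h2
  have e : ∀ ω : Fin m → EuclideanSpace ℝ (Fin p), Real.exp (t * ∑ k, (inner ℝ u (ω k))^2)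
      = ∏ k, Real.exp (t * (inner ℝ u (ω k))^2) := by
    intro ω; rw [Finset.mul_sum, Real.exp_sum]
  simp only [e]
  constructor
  · exact Integrable.fintype_prod (f := fun _ v => Real.exp (t * (inner ℝ u v)^2)) (fun _ => h1)
  · rw [integral_fintype_prod_eq_pow (fun v => Real.exp (t * (inner ℝ u v)^2)), h2]
    simp

lemma jl_up (ε : ℝ) (h0 : 0 < ε) (h1 : ε < 1) :
    (√(1 - 2*(ε/4)))⁻¹ * Real.exp (-(ε/4)*(1+ε)) ≤ Real.exp (-ε^2/8) := by
  have hy := Real.quadratic_le_exp_of_nonneg (x := ε/2 + (ε/2)^2) (by positivity)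
  have h : Real.exp (-(ε/4)*(1+ε) + ε^2/8)^2 ≤ 1 - 2*(ε/4) := by
    rw [← Real.exp_nat_mul]
    have : ((2:ℕ):ℝ) * (-(ε/4)*(1+ε) + ε^2/8) = -(ε/2 + (ε/2)^2) := by push_cast; ring
    rw [this, Real.exp_neg]
    apply inv_le_of_inv_le₀ (by linarith)
    refine le_trans ?_ hy
    rw [inv_le_iff_one_le_mul₀ (by linarith)]
    have h3 : 0 < ε^2 := by positivity
    have : 0 ≤ ε^2 * ((1 - ε/2)*(1+ε/2)^2/2 - ε/2) := by
      apply mul_nonneg h3.le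
      nlinarith [mul_pos h0 (sub_pos.2 h1)]
    nlinarith
  have h2 := Real.le_sqrt_of_sq_le h
  have h3 : 0 < √(1 - 2*(ε/4)) := Real.sqrt_pos.2 (by linarith)
  rw [Real.exp_add] at h2
  have h4 : Real.exp (-ε^2/8) = (Real.exp (ε^2/8))⁻¹ := by rw [← Real.exp_neg]; congr 1; ring
  rw [h4, inv_mul_le_iff₀ h3, ← div_eq_mul_inv, le_div_iff₀ (Real.exp_pos _)]
  exact h2

lemma jl_lo (ε : ℝ) (h0 : 0 < ε) (h1 : ε < 1) :
    (√(1 - 2*(-(ε/2))))⁻¹ * Real.exp ((ε/2)*(1-ε)) ≤ Real.exp (-ε^2/8) := by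
  have hy := Real.le_log_one_add_of_nonneg h0.le
  have h : Real.exp ((ε/2)*(1-ε) + ε^2/8)^2 ≤ 1 - 2*(-(ε/2)) := by
    rw [← Real.exp_nat_mul]
    rw [show 1 - 2*(-(ε/2)) = 1 + ε by ring, ← Real.le_log_iff_exp_le (by linarith)]
    refine le_trans ?_ hy
    rw [le_div_iff₀ (by linarith)]
    push_cast
    nlinarith [mul_pos h0 h0, mul_pos (mul_pos h0 h0) h0]
  have h2 := Real.le_sqrt_of_sq_le h
  have h3 : 0 < √(1 - 2*(-(ε/2))) := Real.sqrt_pos.2 (by linarith)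
  rw [Real.exp_add] at h2
  have h4 : Real.exp (-ε^2/8) = (Real.exp (ε^2/8))⁻¹ := by rw [← Real.exp_neg]; congr 1; ring
  rw [h4, inv_mul_le_iff₀ h3, ← div_eq_mul_inv, le_div_iff₀ (Real.exp_pos _)]
  exact h2

/-- penalty function -/
noncomputable def jlG (p m : ℕ) (ε : ℝ) (u : EuclideanSpace ℝ (Fin p))
    (ω : Fin m → EuclideanSpace ℝ (Fin p)) : ℝ :=
  Real.exp ((ε/4) * ∑ k, (inner ℝ u (ω k))^2) * Real.exp (-(ε/4)*(1+ε)) ^ m +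
  Real.exp (-(ε/2) * ∑ k, (inner ℝ u (ω k))^2) * Real.exp ((ε/2)*(1-ε)) ^ m

lemma jlG_int (p m : ℕ) (ε : ℝ) (h0 : 0 < ε) (h1 : ε < 1) (u : EuclideanSpace ℝ (Fin p))
    (hu : ‖u‖ = 1) :
    Integrable (jlG p m ε u) (Measure.pi fun _ => stdGaussian _) ∧
    ∫ ω, jlG p m ε u ω ∂(Measure.pi fun _ => stdGaussian _) ≤
      2 * Real.exp (-(m : ℝ) * ε ^ 2 / 8) := by
  obtain ⟨a1, a2⟩ := jl_mgf p m u hu (ε/4) (by linarith)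
  obtain ⟨b1, b2⟩ := jl_mgf p m u hu (-(ε/2)) (by linarith)
  unfold jlG
  refine ⟨(a1.mul_const _).add (b1.mul_const _), ?_⟩
  rw [integral_add (a1.mul_const _) (b1.mul_const _), integral_mul_const, integral_mul_const,
    a2, b2, ← mul_pow, ← mul_pow]
  have e : Real.exp (-(m : ℝ) * ε ^ 2 / 8) = Real.exp (-ε^2/8)^m := by
    rw [← Real.exp_nat_mul]; congr 1; ring
  rw [e, two_mul (Real.exp (-ε^2/8)^m)]
  exact add_le_add (pow_le_pow_left₀ (by positivity) (jl_up ε h0 h1) m)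
    (pow_le_pow_left₀ (by positivity) (jl_lo ε h0 h1) m)

lemma jlG_lt (p m : ℕ) (ε : ℝ) (h0 : 0 < ε) (u : EuclideanSpace ℝ (Fin p))
    (ω : Fin m → EuclideanSpace ℝ (Fin p)) (h : jlG p m ε u ω < 1) :
    (1 - ε) * m ≤ ∑ k, (inner ℝ u (ω k))^2 ∧ ∑ k, (inner ℝ u (ω k))^2 ≤ (1 + ε) * m := by
  unfold jlG at h
  rw [← Real.exp_nat_mul, ← Real.exp_nat_mul, ← Real.exp_add, ← Real.exp_add] at h
  generalize (∑ k, (inner ℝ u (ω k))^2 : ℝ) = S at *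
  constructor
  · have := (Real.exp_lt_one_iff (x := _)).1 (lt_of_le_of_lt (le_add_of_nonneg_left (Real.exp_pos _).le) h)
    by_contra! hc
    nlinarith
  · have := (Real.exp_lt_one_iff (x := _)).1 (lt_of_le_of_lt (le_add_of_nonneg_right (Real.exp_pos _).le) h)
    by_contra! hc
    nlinarith

lemma jl_pairs (n : ℕ) : (2:ℝ) * ((Finset.univ : Finset (Fin n × Fin n)).filter (fun q => q.1 < q.2)).card
    = (n:ℝ) * ((n:ℝ) - 1) := by
  classical
  have h1 : ((Finset.univ : Finset (Fin n × Fin n)).filter (fun q => q.1 < q.2)).card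
     = ((Finset.univ : Finset (Fin n × Fin n)).filter (fun q => q.2 < q.1)).card := by
    apply Finset.card_bij (fun q _ => q.swap) <;> simp
  have h2 : (Finset.univ : Finset (Fin n)).offDiag.card = n * n - n := by
    simp [Finset.offDiag_card]
  have h3 : (Finset.univ : Finset (Fin n)).offDiag =
     ((Finset.univ : Finset (Fin n × Fin n)).filter (fun q => q.1 < q.2)) ∪
     ((Finset.univ : Finset (Fin n × Fin n)).filter (fun q => q.2 < q.1)) := by
    ext q; simp [Finset.mem_offDiag, lt_or_lt_iff_ne]
  rw [h3, Finset.card_union_of_disjoint, ← h1] at h2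
  · have h4 : n ≤ n * n := Nat.le_mul_self n
    have h5 : 2 * ((Finset.univ : Finset (Fin n × Fin n)).filter (fun q => q.1 < q.2)).card + n
      = n * n := by omega
    have h6 := congrArg (Nat.cast : ℕ → ℝ) h5
    push_cast at h6
    linarith
  · rw [Finset.disjoint_filter]
    intro q _ h h'
    exact lt_asymm h h'

/-- the random linear map -/
noncomputable def jlF (p m : ℕ) (ω : Fin m → EuclideanSpace ℝ (Fin p)) :
    EuclideanSpace ℝ (Fin p) →ₗ[ℝ] EuclideanSpace ℝ (Fin m) where
  toFun v := WithLp.toLp 2 fun k => (√m)⁻¹ * inner ℝ v (ω k)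
  map_add' a b := by ext k; simp [inner_add_left, mul_add]
  map_smul' c a := by ext k; simp [inner_smul_left]; ring

lemma jlF_norm (p m : ℕ) (ω : Fin m → EuclideanSpace ℝ (Fin p)) (v : EuclideanSpace ℝ (Fin p)) :
    ‖jlF p m ω v‖^2 = (m:ℝ)⁻¹ * ∑ k, (inner ℝ v (ω k))^2 := by
  rw [EuclideanSpace.norm_sq_eq, Finset.mul_sum]
  refine Finset.sum_congr rfl fun k _ => ?_
  simp [jlF, mul_pow]

/-- Johnson–Lindenstrauss lemma. -/
theorem johnson_lindenstrauss
    (n p : ℕ) (hn : 2 ≤ n) (hp : 1 ≤ p)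
    (x : Fin n → EuclideanSpace ℝ (Fin p))
    (ε δ : ℝ) (hε : ε ∈ Set.Ioo (0 : ℝ) 1) (hδ : δ ∈ Set.Ioo (0 : ℝ) 1)
    (m : ℕ) (hm : 1 ≤ m)
    (hbound : (n : ℝ) * ((n : ℝ) - 1) * Real.exp (-(m : ℝ) * ε ^ 2 / 8) ≤ δ) :
    ∃ F : EuclideanSpace ℝ (Fin p) →ₗ[ℝ] EuclideanSpace ℝ (Fin m),
      ∀ i j : Fin n, x i ≠ x j →
        (1 - ε) * ‖x i - x j‖ ^ 2 ≤ ‖F (x i) - F (x j)‖ ^ 2 ∧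
          ‖F (x i) - F (x j)‖ ^ 2 ≤ (1 + ε) * ‖x i - x j‖ ^ 2 := by
  classical
  obtain ⟨h0, h1⟩ := hε
  set A := (Finset.univ : Finset (Fin n × Fin n)).filter (fun q => q.1 < q.2) with hA
  set B := A.filter (fun q => x q.1 ≠ x q.2) with hB
  let U : Fin n × Fin n → EuclideanSpace ℝ (Fin p) := fun q => ‖x q.1 - x q.2‖⁻¹ • (x q.1 - x q.2)
  have hU : ∀ q ∈ B, ‖U q‖ = 1 := by
    intro q hq
    have : x q.1 - x q.2 ≠ 0 := sub_ne_zero.2 (Finset.mem_filter.1 hq).2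
    simp only [U, norm_smul, norm_inv, norm_norm]
    exact inv_mul_cancel₀ (norm_ne_zero_iff.2 this)
  have hint : Integrable (fun ω => ∑ q ∈ B, jlG p m ε (U q) ω)
      (Measure.pi fun _ => stdGaussian _) :=
    integrable_finsetSum _ fun q hq => (jlG_int p m ε h0 h1 _ (hU q hq)).1
  obtain ⟨ω, hω⟩ := exists_le_integral hint
  have hlt : ∑ q ∈ B, jlG p m ε (U q) ω < 1 := by
    refine lt_of_le_of_lt (hω.trans ?_) hδ.2
    rw [integral_finsetSum _ fun q hq => (jlG_int p m ε h0 h1 _ (hU q hq)).1]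
    refine le_trans (Finset.sum_le_sum fun q hq => (jlG_int p m ε h0 h1 _ (hU q hq)).2) ?_
    refine le_trans ?_ hbound
    rw [Finset.sum_const, nsmul_eq_mul, ← jl_pairs]
    have hc : (B.card : ℝ) ≤ A.card := by
      exact_mod_cast Finset.card_le_card (hB ▸ Finset.filter_subset _ A)
    have hmul := mul_le_mul_of_nonneg_right hc
      (mul_nonneg zero_le_two (Real.exp_pos (-(m : ℝ) * ε ^ 2 / 8)).le)
    linarith
  have main : ∀ i j : Fin n, i < j → x i ≠ x j →
        (1 - ε) * ‖x i - x j‖ ^ 2 ≤ ‖jlF p m ω (x i) - jlF p m ω (x j)‖ ^ 2 ∧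
          ‖jlF p m ω (x i) - jlF p m ω (x j)‖ ^ 2 ≤ (1 + ε) * ‖x i - x j‖ ^ 2 := by
    intro i j hij hne
    have hmem : (i, j) ∈ B := by simp [hB, hA, hij, hne]
    have hG : jlG p m ε (U (i, j)) ω < 1 := by
      refine lt_of_le_of_lt ?_ hlt
      refine Finset.single_le_sum (f := fun q => jlG p m ε (U q) ω) (fun q _ => ?_) hmem
      unfold jlG; positivity
    obtain ⟨l1, l2⟩ := jlG_lt p m ε h0 _ ω hG
    have hm0 : (0:ℝ) < m := by exact_mod_cast hm
    rw [← map_sub, jlF_norm]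
    have hv : 0 < ‖x i - x j‖ := norm_pos_iff.2 (sub_ne_zero.2 hne)
    have e : ∑ k, (inner ℝ (U (i, j)) (ω k))^2
        = (‖x i - x j‖^2)⁻¹ * ∑ k, (inner ℝ (x i - x j) (ω k))^2 := by
      rw [Finset.mul_sum]
      refine Finset.sum_congr rfl fun k _ => ?_
      simp only [U, real_inner_smul_left]
      rw [mul_pow, inv_pow]
    rw [e] at l1 l2
    generalize (∑ k, (inner ℝ (x i - x j) (ω k))^2 : ℝ) = S at *
    rw [inv_mul_le_iff₀ (by positivity)] at l2
    rw [le_inv_mul_iff₀ (by positivity)] at l1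
    rw [inv_mul_le_iff₀ hm0, le_inv_mul_iff₀ hm0]
    constructor <;> nlinarith
  refine ⟨jlF p m ω, fun i j hne => ?_⟩
  rcases lt_trichotomy i j with h | h | h
  · exact main i j h hne
  · exact absurd (congrArg x h) hne
  · rw [norm_sub_rev (x i), norm_sub_rev (jlF p m ω (x i))]
    exact main j i h hne.symm
end

section
/- Let X be a standard Gaussian vector in ℝ^k and let F : ℝ^k → ℝ be L-Lipschitz for some L > 0. Then E[exp(u·(F(X) − E[F(X)]))] ≤ exp(π² L² u² / 8) for every u ∈ ℝ, and consequently P(|F(X) − E[F(X)]| > t) ≤ 2·exp(−2t²/(π² L²)) for every t > 0. -/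
open MeasureTheory ProbabilityTheory Matrix Filter
open scoped ProbabilityTheory ENNReal

lemma gP_ac (k : ℕ) : (Measure.pi fun _ : Fin k => gaussianReal 0 1) ≪ volume := by
  rw [volume_pi]
  induction k with
  | zero => rw [Measure.pi_of_empty, Measure.pi_of_empty]
  | succ n ih =>
    have h1 := (measurePreserving_piFinSuccAbove (fun _ : Fin (n+1) => gaussianReal 0 1) 0).symm
    have h2 := (measurePreserving_piFinSuccAbove (fun _ : Fin (n+1) => (volume : Measure ℝ)) 0).symm
    rw [← h1.map_eq, ← h2.map_eq]
    exact ((gaussianReal_absolutelyContinuous 0 one_ne_zero).prod ih).map h1.measurable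

lemma gP_gaussian (k : ℕ) : IsGaussian (Measure.pi fun _ : Fin k => gaussianReal 0 1) := by
  have h : (Measure.pi fun _ : Fin k => gaussianReal 0 1) =
    (stdGaussian (EuclideanSpace ℝ (Fin k))).map (EuclideanSpace.equiv (Fin k) ℝ) := by
    rw [← map_pi_eq_stdGaussian, Measure.map_map (by fun_prop) (by fun_prop)]
    symm
    convert Measure.map_id
    rfl
  rw [h]
  infer_instance

lemma gP_rot (k : ℕ) (θ : ℝ) :
    ((Measure.pi fun _ : Fin k => gaussianReal 0 1).prod
      (Measure.pi fun _ : Fin k => gaussianReal 0 1)).map (ContinuousLinearMap.rotation θ) =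
    ((Measure.pi fun _ : Fin k => gaussianReal 0 1).prod
      (Measure.pi fun _ : Fin k => gaussianReal 0 1)) := by
  have := gP_gaussian k
  apply IsGaussian.map_rotation_eq_self
  ext i
  rw [eval_integral]
  · simp [integral_eval]
  · intro i
    exact integrable_eval (μ := fun _ : Fin k => gaussianReal 0 1) IsGaussian.integrable_id

lemma gP_int (k : ℕ) (c : ℝ) :
    Integrable (fun x : Fin k → ℝ => Real.exp (c * ∑ i, |x i|))
      (Measure.pi fun _ : Fin k => gaussianReal 0 1) := by
  simp_rw [Finset.mul_sum, Real.exp_sum]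
  refine Integrable.fintype_prod (f := fun (_ : Fin k) (x : ℝ) => Real.exp (c * |x|)) fun i => ?_
  exact integrable_exp_mul_abs (X := fun x => x) (integrable_exp_mul_gaussianReal c) (integrable_exp_mul_gaussianReal (-c))

lemma gP_mgf (k : ℕ) (a : Fin k → ℝ) :
    ∫ x, Real.exp (∑ i, a i * x i) ∂(Measure.pi fun _ : Fin k => gaussianReal 0 1) =
      Real.exp ((∑ i, a i ^ 2) / 2) := by
  simp_rw [Real.exp_sum]
  rw [integral_fintype_prod_eq_prod (f := fun (i : Fin k) (x : ℝ) => Real.exp (a i * x)),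
    Finset.sum_div, Real.exp_sum]
  refine Finset.prod_congr rfl fun i _ => ?_
  have := congrFun (mgf_fun_id_gaussianReal (μ := 0) (v := 1)) (a i)
  simpa [mgf] using this

lemma gP_l1 {k : ℕ} (x : Fin k → ℝ) : Real.sqrt (∑ i, x i ^ 2) ≤ ∑ i, |x i| := by
  rw [Real.sqrt_le_left (Finset.sum_nonneg fun i _ => abs_nonneg _)]
  calc ∑ i, x i ^ 2 = ∑ i, |x i| ^ 2 := by simp
    _ ≤ _ := Finset.sum_sq_le_sq_sum_of_nonneg fun i _ => abs_nonneg _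

lemma gP_lip {k : ℕ} {F : (Fin k → ℝ) → ℝ} {L : ℝ} (hL : 0 < L)
    (hLip : ∀ x y : Fin k → ℝ, |F x - F y| ≤ L * Real.sqrt (∑ i, (x i - y i) ^ 2)) :
    LipschitzWith (Real.toNNReal (L * k)) F := by
  refine LipschitzWith.of_dist_le_mul fun x y => ?_
  rw [Real.dist_eq, Real.coe_toNNReal _ (by positivity)]
  calc |F x - F y| ≤ _ := hLip x y
    _ ≤ L * ∑ i, |x i - y i| := by gcongr; exact gP_l1 (fun i => x i - y i)
    _ ≤ L * ∑ i : Fin k, dist x y := by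
      gcongr with i
      exact dist_le_pi_dist x y i
    _ = _ := by simp; ring

lemma gP_fderiv {k : ℕ} {F : (Fin k → ℝ) → ℝ} {L : ℝ} (hL : 0 < L)
    (hLip : ∀ x y : Fin k → ℝ, |F x - F y| ≤ L * Real.sqrt (∑ i, (x i - y i) ^ 2))
    (x : Fin k → ℝ) : ∑ i, (fderiv ℝ F x (Pi.single i 1)) ^ 2 ≤ L ^ 2 := by
  by_cases hd : DifferentiableAt ℝ F x
  swap
  · simp [fderiv_zero_of_not_differentiableAt hd]; positivity
  set a : Fin k → ℝ := fun i => fderiv ℝ F x (Pi.single i 1) with ha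
  have h1 : fderiv ℝ F x a = ∑ i, a i ^ 2 := by
    conv_lhs => rw [pi_eq_sum_univ' a]
    simp [map_sum, ha, sq]
  set s := Real.sqrt (∑ i, a i ^ 2) with hs
  have hss : s ^ 2 = ∑ i, a i ^ 2 := Real.sq_sqrt (Finset.sum_nonneg fun i _ => sq_nonneg _)
  have h2 : HasDerivAt (fun t : ℝ => F (x + t • a)) (fderiv ℝ F x a) 0 := by
    have := hd.hasFDerivAt.hasLineDerivAt a
    exact this
  have h3 : ‖deriv (fun t : ℝ => F (x + t • a)) 0‖ ≤ L * s := by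
    refine norm_deriv_le_of_lip' (by positivity) (Eventually.of_forall fun t => ?_)
    refine (hLip _ _).trans (le_of_eq ?_)
    have : ∑ i, ((x + t • a) i - (x + (0:ℝ) • a) i) ^ 2 = t ^ 2 * ∑ i, a i ^ 2 := by
      rw [Finset.mul_sum]; refine Finset.sum_congr rfl fun i _ => ?_
      simp; ring
    rw [this, Real.sqrt_mul (sq_nonneg _), Real.sqrt_sq_eq_abs]
    simp; ring
  rw [h2.deriv, h1, ← hss, Real.norm_eq_abs, abs_of_nonneg (sq_nonneg _)] at h3
  change ∑ i, a i ^ 2 ≤ _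
  rw [← hss]
  have hs0 : 0 ≤ s := Real.sqrt_nonneg _
  have : s ≤ L := by
    by_contra h
    push Not at h
    nlinarith
  gcongr

lemma gP_int_prod (k : ℕ) (c : ℝ) :
    Integrable (fun p : (Fin k → ℝ) × (Fin k → ℝ) =>
      Real.exp (c * (∑ i, |p.1 i| + ∑ i, |p.2 i|)))
      ((Measure.pi fun _ : Fin k => gaussianReal 0 1).prod
      (Measure.pi fun _ : Fin k => gaussianReal 0 1)) := by
  simp_rw [mul_add, Real.exp_add]
  exact (gP_int k c).mul_prod (gP_int k c)

/-- The increments along a small rotation. -/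
lemma gP_bound {k : ℕ} {F : (Fin k → ℝ) → ℝ} {L : ℝ} (hL : 0 < L)
    (hLip : ∀ x y : Fin k → ℝ, |F x - F y| ≤ L * Real.sqrt (∑ i, (x i - y i) ^ 2))
    (u : ℝ) (n : ℕ) (hn : 0 < n) (x y : Fin k → ℝ) :
    u * (n * (F (Real.cos (Real.pi / 2 / n) • x + Real.sin (Real.pi / 2 / n) • y) - F x)) ≤
      |u| * (L * (Real.pi / 2)) * (∑ i, |x i| + ∑ i, |y i|) := by
  have hn' : (1:ℝ) ≤ n := by exact_mod_cast hn
  set h := Real.pi / 2 / n with hh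
  have hnh : n * h = Real.pi / 2 := by rw [hh]; field_simp
  have h0 : 0 ≤ h := by positivity
  have h2 : h ≤ 2 := by
    have : h ≤ Real.pi / 2 := div_le_self (by positivity) hn'
    linarith [Real.pi_le_four]
  have hc : |Real.cos h - 1| ≤ h := by
    rw [abs_sub_comm, abs_of_nonneg (by linarith [Real.cos_le_one h])]
    nlinarith [Real.one_sub_sq_div_two_le_cos (x := h)]
  have hsn : |Real.sin h| ≤ h := by
    simpa [abs_of_nonneg h0] using Real.abs_sin_le_abs (x := h)
  have key : |F (Real.cos h • x + Real.sin h • y) - F x| ≤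
      L * (h * (∑ i, |x i| + ∑ i, |y i|)) := by
    refine (hLip _ _).trans ?_
    gcongr
    refine (gP_l1 (fun i => (Real.cos h • x + Real.sin h • y) i - x i)).trans ?_
    rw [mul_add, Finset.mul_sum, Finset.mul_sum, ← Finset.sum_add_distrib]
    gcongr with i
    have : (Real.cos h • x + Real.sin h • y) i - x i = (Real.cos h - 1) * x i + Real.sin h * y i := by
      simp; ring
    rw [this]
    refine (abs_add_le _ _).trans ?_
    rw [abs_mul, abs_mul]
    gcongr
  calc _ ≤ |u * (n * (F (Real.cos h • x + Real.sin h • y) - F x))| := le_abs_self _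
    _ = |u| * (n * |F (Real.cos h • x + Real.sin h • y) - F x|) := by
      rw [abs_mul, abs_mul, Nat.abs_cast]
    _ ≤ |u| * (n * (L * (h * (∑ i, |x i| + ∑ i, |y i|)))) := by gcongr
    _ = |u| * (L * (n * h)) * (∑ i, |x i| + ∑ i, |y i|) := by ring
    _ = _ := by rw [hnh]

lemma gP_int_step {k : ℕ} {F : (Fin k → ℝ) → ℝ} {L : ℝ} (hL : 0 < L)
    (hLip : ∀ x y : Fin k → ℝ, |F x - F y| ≤ L * Real.sqrt (∑ i, (x i - y i) ^ 2))
    (u : ℝ) (n : ℕ) (hn : 0 < n) :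
    Integrable (fun p : (Fin k → ℝ) × (Fin k → ℝ) => Real.exp
      (u * (n * (F (Real.cos (Real.pi / 2 / n) • p.1 + Real.sin (Real.pi / 2 / n) • p.2) - F p.1))))
      ((Measure.pi fun _ : Fin k => gaussianReal 0 1).prod
      (Measure.pi fun _ : Fin k => gaussianReal 0 1)) := by
  have hc := (gP_lip hL hLip).continuous
  refine (gP_int_prod k (|u| * (L * (Real.pi / 2)))).mono' 
    (Continuous.aestronglyMeasurable (by fun_prop)) (Eventually.of_forall fun p => ?_)
  rw [Real.norm_eq_abs, Real.abs_exp, Real.exp_le_exp]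
  exact gP_bound hL hLip u n hn _ _

lemma gP_step {k : ℕ} {F : (Fin k → ℝ) → ℝ} {L : ℝ} (hL : 0 < L)
    (hLip : ∀ x y : Fin k → ℝ, |F x - F y| ≤ L * Real.sqrt (∑ i, (x i - y i) ^ 2))
    (u : ℝ) (n : ℕ) (hn : 0 < n) :
    ∫ p : (Fin k → ℝ) × (Fin k → ℝ), Real.exp (u * (F p.2 - F p.1))
      ∂((Measure.pi fun _ : Fin k => gaussianReal 0 1).prod
      (Measure.pi fun _ : Fin k => gaussianReal 0 1)) ≤
    ∫ p : (Fin k → ℝ) × (Fin k → ℝ), Real.exp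
      (u * (n * (F (Real.cos (Real.pi / 2 / n) • p.1 + Real.sin (Real.pi / 2 / n) • p.2) - F p.1)))
      ∂((Measure.pi fun _ : Fin k => gaussianReal 0 1).prod
      (Measure.pi fun _ : Fin k => gaussianReal 0 1)) := by
  set ν := ((Measure.pi fun _ : Fin k => gaussianReal 0 1).prod
      (Measure.pi fun _ : Fin k => gaussianReal 0 1)) with hν
  have hc := (gP_lip hL hLip).continuous
  have hn0 : (n : ℝ) ≠ 0 := by positivity
  set h := Real.pi / 2 / n with hh
  have hnh : n * h = Real.pi / 2 := by rw [hh]; field_simp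
  have hint := gP_int_step hL hLip u n hn
  rw [← hh, ← hν] at hint
  set G : (Fin k → ℝ) × (Fin k → ℝ) → ℝ := fun p => Real.exp
      (u * (n * (F (Real.cos h • p.1 + Real.sin h • p.2) - F p.1))) with hG
  have hmp : ∀ θ : ℝ, MeasurePreserving (ContinuousLinearMap.rotation (E := Fin k → ℝ) θ) ν ν :=
    fun θ => ⟨by fun_prop, gP_rot k θ⟩
  have hi : ∀ θ : ℝ, Integrable (fun p => G (ContinuousLinearMap.rotation θ p)) ν :=
    fun θ => (hmp θ).integrable_comp_of_integrable hint
  have hI : ∀ θ : ℝ, ∫ p, G (ContinuousLinearMap.rotation θ p) ∂ν = ∫ p, G p ∂ν := fun θ => by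
    conv_rhs => rw [← (hmp θ).map_eq]
    rw [integral_map (by fun_prop)]
    exact Continuous.aestronglyMeasurable (by fun_prop)
  have hpt : ∀ p : (Fin k → ℝ) × (Fin k → ℝ), Real.exp (u * (F p.2 - F p.1)) ≤
      ∑ j ∈ Finset.range n, (1 / n : ℝ) * G (ContinuousLinearMap.rotation (j * h) p) := by
    intro p
    let f : ℕ → ℝ := fun j => F (Real.cos (j * h) • p.1 + Real.sin (j * h) • p.2)
    have e1 : u * (F p.2 - F p.1) =
        ∑ j ∈ Finset.range n, (1 / n : ℝ) • (u * (n * (f (j + 1) - f j))) := by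
      have : ∀ j ∈ Finset.range n, (1 / n : ℝ) • (u * (n * (f (j + 1) - f j))) =
        u * (f (j + 1) - f j) := fun j _ => by rw [smul_eq_mul]; field_simp
      rw [Finset.sum_congr rfl this, ← Finset.mul_sum, Finset.sum_range_sub]
      simp [f, hnh]
    rw [e1]
    refine (convexOn_exp.map_sum_le (fun _ _ => by positivity) (by simp [hn0]) (by simp)).trans ?_
    refine le_of_eq (Finset.sum_congr rfl fun j _ => ?_)
    rw [smul_eq_mul, hG]
    simp only [ContinuousLinearMap.rotation_apply, f]
    have e2 : Real.cos ((j + 1 : ℕ) * h) • p.1 + Real.sin ((j + 1 : ℕ) * h) • p.2 =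
        Real.cos h • (Real.cos (j * h) • p.1 + Real.sin (j * h) • p.2) +
        Real.sin h • (-Real.sin (j * h) • p.1 + Real.cos (j * h) • p.2) := by
      push_cast
      rw [add_mul, one_mul, Real.cos_add, Real.sin_add]
      ext i
      simp
      ring
    rw [e2]
  calc _ ≤ ∫ p, ∑ j ∈ Finset.range n, (1 / n : ℝ) * G (ContinuousLinearMap.rotation (j * h) p) ∂ν := by
        refine integral_mono_of_nonneg (Eventually.of_forall fun p => (Real.exp_pos _).le)
          (integrable_finsetSum _ fun j _ => (hi _).const_mul _) (Eventually.of_forall hpt)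
    _ = ∑ j ∈ Finset.range n, (1 / n : ℝ) * ∫ p, G p ∂ν := by
        rw [integral_finsetSum _ fun j _ => (hi _).const_mul _]
        refine Finset.sum_congr rfl fun j _ => ?_
        rw [integral_const_mul, hI]
    _ = _ := by simp; field_simp

lemma gP_main {k : ℕ} {F : (Fin k → ℝ) → ℝ} {L : ℝ} (hL : 0 < L)
    (hLip : ∀ x y : Fin k → ℝ, |F x - F y| ≤ L * Real.sqrt (∑ i, (x i - y i) ^ 2))
    (u : ℝ) :
    ∫ p : (Fin k → ℝ) × (Fin k → ℝ), Real.exp (u * (F p.2 - F p.1))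
      ∂((Measure.pi fun _ : Fin k => gaussianReal 0 1).prod
      (Measure.pi fun _ : Fin k => gaussianReal 0 1)) ≤
    Real.exp (Real.pi ^ 2 * L ^ 2 * u ^ 2 / 8) := by
  set μ := (Measure.pi fun _ : Fin k => gaussianReal 0 1) with hμ
  have hc := (gP_lip hL hLip).continuous
  have hdiff : ∀ᵐ p ∂(μ.prod μ), DifferentiableAt ℝ F p.1 := by
    have h1 : ∀ᵐ x ∂μ, DifferentiableAt ℝ F x :=
      (gP_ac k).ae_le (gP_lip hL hLip).ae_differentiableAt
    exact Measure.quasiMeasurePreserving_fst.ae h1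
  have hlim := tendsto_integral_of_dominated_convergence (μ := μ.prod μ)
    (F := fun (n : ℕ) (p : (Fin k → ℝ) × (Fin k → ℝ)) => Real.exp
      (u * ((n + 1 : ℕ) * (F (Real.cos (Real.pi / 2 / (n + 1 : ℕ)) • p.1 +
        Real.sin (Real.pi / 2 / (n + 1 : ℕ)) • p.2) - F p.1))))
    (f := fun p => Real.exp (u * (Real.pi / 2 * fderiv ℝ F p.1 p.2)))
    _ (fun n => Continuous.aestronglyMeasurable (by fun_prop))
    (gP_int_prod k (|u| * (L * (Real.pi / 2))))
    (fun n => Eventually.of_forall fun p => by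
      rw [Real.norm_eq_abs, Real.abs_exp, Real.exp_le_exp]
      exact gP_bound hL hLip u (n + 1) (by omega) _ _)
    (by
      filter_upwards [hdiff] with p hp
      refine (Real.continuous_exp.tendsto _).comp (Tendsto.const_mul _ ?_)
      have hcurve : HasDerivAt (fun t : ℝ => Real.cos t • p.1 + Real.sin t • p.2) p.2 0 := by
        have := ((Real.hasDerivAt_cos 0).smul_const p.1).add ((Real.hasDerivAt_sin 0).smul_const p.2)
        simp only [Real.sin_zero, Real.cos_zero, neg_zero, zero_smul, one_smul, zero_add] at this
        exact this
      have hp' : HasFDerivAt F (fderiv ℝ F p.1) (Real.cos 0 • p.1 + Real.sin 0 • p.2) := by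
        simpa using hp.hasFDerivAt
      have hD := hp'.comp_hasDerivAt (0 : ℝ) hcurve
      have ht : Tendsto (fun n : ℕ => Real.pi / 2 / (n + 1 : ℕ)) atTop (nhdsWithin 0 {0}ᶜ) := by
        refine tendsto_nhdsWithin_iff.2 ⟨?_, Eventually.of_forall fun n => ?_⟩
        · exact (tendsto_const_div_atTop_nhds_zero_nat (Real.pi / 2)).comp (tendsto_add_atTop_nat 1)
        · simp only [Set.mem_compl_iff, Set.mem_singleton_iff]
          positivity
      have := ((hasDerivAt_iff_tendsto_slope_zero.1 hD).comp ht).const_mul (Real.pi / 2)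
      refine this.congr fun n => ?_
      simp only [Function.comp_apply, zero_add, Real.cos_zero, Real.sin_zero, one_smul, zero_smul,
        add_zero, smul_eq_mul]
      rw [← mul_assoc]
      congr 1
      field_simp)
  refine (ge_of_tendsto' hlim fun n => gP_step hL hLip u (n + 1) (by omega)).trans ?_
  by_cases hi : Integrable (fun p => Real.exp (u * (Real.pi / 2 * fderiv ℝ F p.1 p.2))) (μ.prod μ)
  swap
  · rw [integral_undef hi]; positivity
  rw [integral_prod _ hi]
  calc _ ≤ ∫ x : Fin k → ℝ, Real.exp (Real.pi ^ 2 * L ^ 2 * u ^ 2 / 8) ∂μ := by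
        refine integral_mono_of_nonneg (Eventually.of_forall fun p =>
          integral_nonneg fun _ => (Real.exp_pos _).le) (integrable_const _)
          (Eventually.of_forall fun x => ?_)
        have e : ∀ y : Fin k → ℝ, u * (Real.pi / 2 * fderiv ℝ F x y) =
            ∑ i, (u * (Real.pi / 2) * fderiv ℝ F x (Pi.single i 1)) * y i := by
          intro y
          conv_lhs => rw [pi_eq_sum_univ' y]
          rw [map_sum, Finset.mul_sum, Finset.mul_sum]
          refine Finset.sum_congr rfl fun i _ => ?_
          rw [map_smul, smul_eq_mul]; ring
        simp only [e]
        rw [hμ, gP_mgf, Real.exp_le_exp]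
        simp_rw [mul_pow]
        rw [← Finset.mul_sum]
        have := gP_fderiv hL hLip x
        have h2 : 0 ≤ u ^ 2 * (Real.pi / 2) ^ 2 := by positivity
        nlinarith [mul_le_mul_of_nonneg_left this h2]
    _ = _ := by simp

lemma gP_subG {k : ℕ} {F : (Fin k → ℝ) → ℝ} {L : ℝ} (hL : 0 < L)
    (hLip : ∀ x y : Fin k → ℝ, |F x - F y| ≤ L * Real.sqrt (∑ i, (x i - y i) ^ 2)) :
    HasSubgaussianMGF (fun x => F x - ∫ y, F y ∂(Measure.pi fun _ : Fin k => gaussianReal 0 1))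
      (Real.toNNReal (Real.pi ^ 2 * L ^ 2 / 4)) (Measure.pi fun _ : Fin k => gaussianReal 0 1) := by
  set μ := (Measure.pi fun _ : Fin k => gaussianReal 0 1) with hμ
  have hc := (gP_lip hL hLip).continuous
  have hbd : ∀ x, |F x| ≤ |F 0| + L * ∑ i, |x i| := fun x => by
    have h1 := hLip x 0
    have h2 := gP_l1 x
    simp only [Pi.zero_apply, sub_zero] at h1
    have h3 : |F x| ≤ |F 0| + |F x - F 0| := by
      have := abs_add_le (F 0) (F x - F 0); simpa using this
    nlinarith
  have hexp : ∀ u : ℝ, Integrable (fun x => Real.exp (u * F x)) μ := fun u => by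
    refine ((gP_int k (|u| * L)).const_mul (Real.exp (|u| * |F 0|))).mono'
      (Continuous.aestronglyMeasurable (by fun_prop)) (Eventually.of_forall fun x => ?_)
    rw [Real.norm_eq_abs, Real.abs_exp, ← Real.exp_add, Real.exp_le_exp]
    calc u * F x ≤ |u| * |F x| := by rw [← abs_mul]; exact le_abs_self _
      _ ≤ |u| * (|F 0| + L * ∑ i, |x i|) := by gcongr; exact hbd x
      _ = _ := by ring
  have hFi : Integrable F μ := by
    refine ((hexp 1).add (hexp (-1))).mono' hc.aestronglyMeasurable
      (Eventually.of_forall fun x => ?_)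
    rw [Real.norm_eq_abs, Pi.add_apply, one_mul, neg_one_mul]
    have h1 := Real.add_one_le_exp (F x)
    have h2 := Real.add_one_le_exp (-F x)
    have h3 := Real.exp_pos (F x)
    have h4 := Real.exp_pos (-F x)
    rw [abs_le]; constructor <;> linarith
  refine ⟨fun u => ?_, fun u => ?_⟩
  · have : (fun x => Real.exp (u * (F x - ∫ y, F y ∂μ))) =
      fun x => Real.exp (u * F x) * Real.exp (-(u * ∫ y, F y ∂μ)) := by
      ext x; rw [← Real.exp_add]; congr 1; ring
    rw [this]; exact (hexp u).mul_const _
  · have hm := gP_main hL hLip u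
    rw [← hμ] at hm
    have e1 : ∀ p : (Fin k → ℝ) × (Fin k → ℝ), Real.exp (u * (F p.2 - F p.1)) =
      Real.exp (-u * F p.1) * Real.exp (u * F p.2) := fun p => by
      rw [← Real.exp_add]; congr 1; ring
    simp_rw [e1] at hm
    rw [integral_prod_mul (fun x => Real.exp (-u * F x)) (fun x => Real.exp (u * F x))] at hm
    have hJ : Real.exp (-u * ∫ y, F y ∂μ) ≤ ∫ y, Real.exp (-u * F y) ∂μ := by
      have := convexOn_exp.map_integral_le (μ := μ) (f := fun y => -u * F y)
        Real.continuous_exp.continuousOn isClosed_univ (by simp) (hFi.const_mul _) (hexp (-u))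
      rwa [integral_const_mul] at this
    have hp : 0 ≤ ∫ y, Real.exp (u * F y) ∂μ := integral_nonneg fun _ => (Real.exp_pos _).le
    calc mgf (fun x => F x - ∫ y, F y ∂μ) μ u
        = Real.exp (-u * ∫ y, F y ∂μ) * ∫ y, Real.exp (u * F y) ∂μ := by
          rw [mgf, ← integral_const_mul]
          congr 1; ext x; rw [← Real.exp_add]; congr 1; ring
      _ ≤ _ := mul_le_mul_of_nonneg_right hJ hp
      _ ≤ _ := hm
      _ = _ := by
          rw [Real.coe_toNNReal _ (by positivity)]; congr 1; ring

/-- Gaussian concentration for Lipschitz functions, with the Maurey–Pisier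
constant π²L²/8 in the mgf bound. -/
theorem gaussian_lipschitz_concentration_pisier
    {Ω : Type*} [MeasureSpace Ω] [IsProbabilityMeasure (ℙ : Measure Ω)]
    (k : ℕ) (X : Ω → Fin k → ℝ) (hX : Measurable X)
    (hlaw : Measure.map X ℙ = Measure.pi fun _ : Fin k => gaussianReal 0 1)
    (F : (Fin k → ℝ) → ℝ) (L : ℝ) (hL : 0 < L)
    (hLip : ∀ x y : Fin k → ℝ, |F x - F y| ≤ L * Real.sqrt (∑ i, (x i - y i) ^ 2)) :
    (∀ u : ℝ,
      ∫⁻ ω, ENNReal.ofReal (Real.exp (u * (F (X ω) - ∫ ω', F (X ω') ∂ℙ))) ∂ℙ ≤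
        ENNReal.ofReal (Real.exp (Real.pi ^ 2 * L ^ 2 * u ^ 2 / 8))) ∧
    (∀ t : ℝ, 0 < t →
      ℙ {ω | t < |F (X ω) - ∫ ω', F (X ω') ∂ℙ|} ≤
        ENNReal.ofReal (2 * Real.exp (-2 * t ^ 2 / (Real.pi ^ 2 * L ^ 2)))) := by
  have hc := (gP_lip hL hLip).continuous
  have hE : ∫ ω', F (X ω') ∂ℙ = ∫ y, F y ∂(Measure.pi fun _ : Fin k => gaussianReal 0 1) := by
    rw [← hlaw, integral_map hX.aemeasurable hc.aestronglyMeasurable]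
  have hS := gP_subG hL hLip
  rw [← hE, ← hlaw] at hS
  set m := ∫ ω', F (X ω') ∂ℙ with hm
  have hcoe : ((Real.toNNReal (Real.pi ^ 2 * L ^ 2 / 4) : NNReal) : ℝ) =
    Real.pi ^ 2 * L ^ 2 / 4 := Real.coe_toNNReal _ (by positivity)
  have hS' : HasSubgaussianMGF (fun ω => F (X ω) - m)
      (Real.toNNReal (Real.pi ^ 2 * L ^ 2 / 4)) (ℙ : Measure Ω) :=
    HasSubgaussianMGF.of_map hX.aemeasurable hS
  refine ⟨fun u => ?_, fun t ht => ?_⟩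
  · rw [← ofReal_integral_eq_lintegral_ofReal (hS'.integrable_exp_mul u)
      (Eventually.of_forall fun _ => (Real.exp_pos _).le)]
    apply ENNReal.ofReal_le_ofReal
    refine (hS'.mgf_le u).trans (le_of_eq ?_)
    rw [hcoe]; congr 1; ring
  · have h1 := hS'.measure_ge_le ht.le
    have h2 := hS'.neg.measure_ge_le ht.le
    have e : -t ^ 2 / (2 * (Real.pi ^ 2 * L ^ 2 / 4)) = -2 * t ^ 2 / (Real.pi ^ 2 * L ^ 2) := by
      have := Real.pi_pos
      field_simp
      ring
    rw [hcoe, e] at h1 h2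
    calc _ ≤ ℙ ({ω | t ≤ F (X ω) - m} ∪ {ω | t ≤ (-fun ω => F (X ω) - m) ω}) := by
          refine measure_mono fun ω hω => ?_
          rcases lt_abs.1 (show t < |F (X ω) - m| from hω) with h | h
          · exact Or.inl h.le
          · exact Or.inr h.le
      _ ≤ _ := measure_union_le _ _
      _ ≤ ENNReal.ofReal _ + ENNReal.ofReal _ :=
        add_le_add ((ENNReal.le_ofReal_iff_toReal_le (measure_ne_top _ _) (Real.exp_pos _).le).2 h1)
          ((ENNReal.le_ofReal_iff_toReal_le (measure_ne_top _ _) (Real.exp_pos _).le).2 h2)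
      _ = _ := by
        rw [← ENNReal.ofReal_add (Real.exp_pos _).le (Real.exp_pos _).le, two_mul]
end

section
/- (James–Stein dominance) Let p ≥ 3 be an integer, μ ∈ ℝ^p, σ > 0, and let X be a random vector with distribution N(μ, σ²·Id_p). Define the James–Stein estimator μ̂_JS = (1 − (p−2)σ²/‖X‖²)·X (well defined since ‖X‖ > 0 almost surely). Then E[‖X‖^{−2}] < ∞ and E[‖μ̂_JS − μ‖²] = pσ² − (p−2)²σ⁴·E[‖X‖^{−2}]; in particular E[‖μ̂_JS − μ‖²] < pσ² = E[‖X − μ‖²]. -/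
open MeasureTheory ProbabilityTheory Matrix Filter
open scoped ProbabilityTheory ENNReal

lemma js_hasDerivAt_pdf (m : ℝ) (v : NNReal) (hv : v ≠ 0) (x : ℝ) :
    HasDerivAt (gaussianPDFReal m v) (-((x - m) / v) * gaussianPDFReal m v x) x := by
  have hv' : (v : ℝ) ≠ 0 := by exact_mod_cast hv
  have h1 : HasDerivAt (fun x : ℝ => -(x - m) ^ 2 / (2 * v)) (-((x - m) / v)) x := by
    have := ((((hasDerivAt_id x).sub_const m).pow 2).neg).div_const (2 * (v : ℝ))
    refine this.congr_deriv ?_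
    simp
    field_simp
  have := (h1.exp).const_mul (√(2 * Real.pi * v))⁻¹
  rw [gaussianPDFReal_def]
  refine this.congr_deriv ?_
  ring

lemma js_integrable_gaussian {m : ℝ} {v : NNReal} (hv : v ≠ 0) {f : ℝ → ℝ}
    (hf : Integrable f (gaussianReal m v)) : Integrable (fun x => gaussianPDFReal m v x * f x) := by
  rw [gaussianReal_of_var_ne_zero _ hv] at hf
  rw [integrable_withDensity_iff_integrable_smul' (measurable_gaussianPDF _ _)
    (ae_of_all _ fun _ => gaussianPDF_lt_top)] at hf
  simpa [toReal_gaussianPDF] using hf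

lemma js_integrable_sub (m : ℝ) (v : NNReal) : Integrable (fun x => x - m) (gaussianReal m v) :=
  ((memLp_id_gaussianReal (μ := m) (v := v) 1).integrable (by simp)).sub (integrable_const m)

lemma js_stein_one (m : ℝ) (v : NNReal) (hv : v ≠ 0) (g g' : ℝ → ℝ) (C : ℝ)
    (hg : ∀ x, HasDerivAt g (g' x) x) (hm' : Measurable g') (hb : ∀ x, |g x| ≤ C)
    (hb' : ∀ x, |g' x| ≤ C) :
    ∫ x, (x - m) * g x ∂(gaussianReal m v) = v * ∫ x, g' x ∂(gaussianReal m v) := by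
  have hv' : (v : ℝ) ≠ 0 := by exact_mod_cast hv
  have hgm : Measurable g :=
    (continuous_iff_continuousAt.2 fun x => (hg x).continuousAt).measurable
  have i1 : Integrable g (gaussianReal m v) :=
    Integrable.of_bound hgm.aestronglyMeasurable C (ae_of_all _ hb)
  have i2 : Integrable g' (gaussianReal m v) :=
    Integrable.of_bound hm'.aestronglyMeasurable C (ae_of_all _ hb')
  have i3 : Integrable (fun x => (x - m) * g x) (gaussianReal m v) :=
    (js_integrable_sub m v).mul_bdd hgm.aestronglyMeasurable (ae_of_all _ hb)
  have key := integral_mul_deriv_eq_deriv_mul_of_integrable (u := g) (u' := g')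
    (v := gaussianPDFReal m v) (v' := fun x => -((x - m) / v) * gaussianPDFReal m v x)
    (fun x _ => hg x) (fun x _ => js_hasDerivAt_pdf m v hv x)
    (((js_integrable_gaussian hv i3).const_mul (-(v : ℝ)⁻¹)).congr
      (ae_of_all _ fun x => by simp; ring))
    ((js_integrable_gaussian hv i2).congr (ae_of_all _ fun x => by simp; ring))
    ((js_integrable_gaussian hv i1).congr (ae_of_all _ fun x => by simp; ring))
  rw [integral_gaussianReal_eq_integral_smul hv, integral_gaussianReal_eq_integral_smul hv]
  have e1 : ∫ x, g x * (-((x - m) / v) * gaussianPDFReal m v x)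
      = -(v : ℝ)⁻¹ * ∫ x, gaussianPDFReal m v x • ((x - m) * g x) := by
    rw [← integral_const_mul]
    congr 1; ext x; simp; ring
  have e2 : ∫ x, g' x * gaussianPDFReal m v x = ∫ x, gaussianPDFReal m v x • g' x := by
    congr 1; ext x; simp; ring
  rw [e1, e2] at key
  field_simp at key
  linarith

lemma js_stein_pi {n : ℕ} (μ : Fin (n + 1) → ℝ) (v : NNReal) (hv : v ≠ 0) (i : Fin (n + 1))
    (F F' : (Fin (n + 1) → ℝ) → ℝ) (C : ℝ) (hF : Measurable F) (hF' : Measurable F')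
    (hb : ∀ x, |F x| ≤ C) (hb' : ∀ x, |F' x| ≤ C)
    (hd : ∀ (y : Fin n → ℝ) (t : ℝ), HasDerivAt (fun t => F (i.insertNth t y))
      (F' (i.insertNth t y)) t) :
    Integrable (fun x => (x i - μ i) * F x) (Measure.pi fun i => gaussianReal (μ i) v) ∧
    Integrable F' (Measure.pi fun i => gaussianReal (μ i) v) ∧
    ∫ x, (x i - μ i) * F x ∂(Measure.pi fun i => gaussianReal (μ i) v)
      = v * ∫ x, F' x ∂(Measure.pi fun i => gaussianReal (μ i) v) := by
  have hmp := (measurePreserving_piFinSuccAbove (fun i => gaussianReal (μ i) v) i).symm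
  have i2 : Integrable F' (Measure.pi fun i => gaussianReal (μ i) v) :=
    Integrable.of_bound hF'.aestronglyMeasurable C (ae_of_all _ hb')
  have i3 : Integrable (fun x => (x i - μ i) * F x) (Measure.pi fun i => gaussianReal (μ i) v) := by
    refine Integrable.mul_bdd ?_ hF.aestronglyMeasurable (ae_of_all _ hb)
    exact (measurePreserving_eval (fun i => gaussianReal (μ i) v) i).integrable_comp_of_integrable
      (js_integrable_sub (μ i) v)
  have i2' := hmp.integrable_comp_of_integrable i2
  have i3' := hmp.integrable_comp_of_integrable i3
  simp only [Function.comp_def] at i2' i3'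
  refine ⟨i3, i2, ?_⟩
  rw [← hmp.integral_comp', ← hmp.integral_comp', integral_prod_symm _ i3',
    integral_prod_symm _ i2', ← integral_const_mul]
  congr 1
  ext y
  have hins : Measurable fun t : ℝ => (i.insertNth t y : Fin (n + 1) → ℝ) :=
    (MeasurableEquiv.piFinSuccAbove (fun _ => ℝ) i).symm.measurable.comp
      (measurable_id.prodMk measurable_const)
  have := js_stein_one (μ i) v hv (fun t => F (i.insertNth t y)) (fun t => F' (i.insertNth t y)) C
    (hd y) (hF'.comp hins) (fun _ => hb _) (fun _ => hb' _)
  simpa [MeasurableEquiv.piFinSuccAbove_symm_apply, Fin.insertNthEquiv] using this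


lemma js_eps_coord {n : ℕ} (μ : Fin (n + 1) → ℝ) (v : NNReal) (hv : v ≠ 0) (i : Fin (n + 1))
    (ε : ℝ) (hε : 0 < ε) :
    Integrable (fun x : Fin (n + 1) → ℝ => (x i - μ i) * (x i / (∑ j, x j ^ 2 + ε)))
      (Measure.pi fun i => gaussianReal (μ i) v) ∧
    Integrable (fun x : Fin (n + 1) → ℝ => 1 / (∑ j, x j ^ 2 + ε)
        - 2 * x i ^ 2 / (∑ j, x j ^ 2 + ε) ^ 2) (Measure.pi fun i => gaussianReal (μ i) v) ∧
    ∫ x : Fin (n + 1) → ℝ, (x i - μ i) * (x i / (∑ j, x j ^ 2 + ε))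
        ∂(Measure.pi fun i => gaussianReal (μ i) v)
      = v * ∫ x : Fin (n + 1) → ℝ, (1 / (∑ j, x j ^ 2 + ε)
        - 2 * x i ^ 2 / (∑ j, x j ^ 2 + ε) ^ 2)
        ∂(Measure.pi fun i => gaussianReal (μ i) v) := by
  have hle : ∀ x : Fin (n + 1) → ℝ, x i ^ 2 ≤ ∑ j, x j ^ 2 := fun x =>
    Finset.single_le_sum (f := fun j => x j ^ 2) (fun j _ => sq_nonneg _) (Finset.mem_univ i)
  refine js_stein_pi μ v hv i (fun x => x i / (∑ j, x j ^ 2 + ε))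
    (fun x => 1 / (∑ j, x j ^ 2 + ε) - 2 * x i ^ 2 / (∑ j, x j ^ 2 + ε) ^ 2) (1 + 2 / ε)
    (by fun_prop) (by fun_prop) ?_ ?_ ?_
  · intro x
    have h := hle x
    generalize ∑ j, x j ^ 2 = S at *
    have hS : 0 < S + ε := by nlinarith [sq_nonneg (x i)]
    rw [abs_div, abs_of_pos hS, div_le_iff₀ hS]
    have : (1 + 2 / ε) * (S + ε) = S + ε + 2 / ε * S + 2 := by field_simp; ring
    rw [this]
    have h2 : 0 ≤ 2 / ε * S := by have : 0 ≤ S := by nlinarith [sq_nonneg (x i)]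
                                  positivity
    nlinarith [sq_abs (x i), sq_nonneg (|x i| - 1)]
  · intro x
    have h := hle x
    generalize ∑ j, x j ^ 2 = S at *
    have hx := sq_nonneg (x i)
    have hS : 0 < S + ε := by linarith
    have h1 : 1 / (S + ε) ≤ 1 / ε := one_div_le_one_div_of_le hε (by linarith)
    have h2 : 2 * x i ^ 2 / (S + ε) ^ 2 ≤ 2 / (S + ε) := by
      rw [div_le_div_iff₀ (by positivity) hS]
      nlinarith
    have h3 : 0 ≤ 2 * x i ^ 2 / (S + ε) ^ 2 := by positivity
    have h4 : 2 / (S + ε) = 2 * (1 / (S + ε)) := by ring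
    have h5 : 2 / ε = 2 * (1 / ε) := by ring
    have h6 : 0 < 1 / (S + ε) := by positivity
    rw [abs_le]
    constructor <;> linarith
  · intro y t
    simp only [Fin.sum_univ_succAbove _ i, Fin.insertNth_apply_same, Fin.insertNth_apply_succAbove]
    have hR : 0 ≤ ∑ j, y j ^ 2 := Finset.sum_nonneg fun j _ => sq_nonneg _
    generalize ∑ j, y j ^ 2 = R at *
    have hS : t ^ 2 + R + ε ≠ 0 := by positivity
    have := (hasDerivAt_id t).div ((((hasDerivAt_id t).pow 2).add_const R).add_const ε) hS
    refine this.congr_deriv ?_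
    simp
    field_simp

lemma js_eps {n : ℕ} (μ : Fin (n + 1) → ℝ) (v : NNReal) (hv : v ≠ 0) (ε : ℝ) (hε : 0 < ε) :
    Integrable (fun x : Fin (n + 1) → ℝ => (∑ j, (x j - μ j) * x j) / (∑ j, x j ^ 2 + ε))
      (Measure.pi fun i => gaussianReal (μ i) v) ∧
    ∫ x : Fin (n + 1) → ℝ, (∑ j, (x j - μ j) * x j) / (∑ j, x j ^ 2 + ε)
        ∂(Measure.pi fun i => gaussianReal (μ i) v)
      = v * ∫ x : Fin (n + 1) → ℝ, ((n + 1) / (∑ j, x j ^ 2 + ε)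
        - 2 * (∑ j, x j ^ 2) / (∑ j, x j ^ 2 + ε) ^ 2)
        ∂(Measure.pi fun i => gaussianReal (μ i) v) := by
  have h := fun i => js_eps_coord μ v hv i ε hε
  have e1 : ∀ x : Fin (n + 1) → ℝ, (∑ j, (x j - μ j) * x j) / (∑ j, x j ^ 2 + ε)
      = ∑ i, (x i - μ i) * (x i / (∑ j, x j ^ 2 + ε)) := fun x => by
    rw [Finset.sum_div]; exact Finset.sum_congr rfl fun i _ => by ring
  have e2 : ∀ x : Fin (n + 1) → ℝ, ((n + 1) / (∑ j, x j ^ 2 + ε)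
        - 2 * (∑ j, x j ^ 2) / (∑ j, x j ^ 2 + ε) ^ 2)
      = ∑ i, (1 / (∑ j, x j ^ 2 + ε) - 2 * x i ^ 2 / (∑ j, x j ^ 2 + ε) ^ 2) := fun x => by
    rw [Finset.sum_sub_distrib, ← Finset.sum_div, ← Finset.sum_div, ← Finset.mul_sum]
    simp
  simp_rw [e1, e2]
  refine ⟨integrable_finsetSum _ fun i _ => (h i).1, ?_⟩
  rw [integral_finsetSum _ fun i _ => (h i).1, integral_finsetSum _ fun i _ => (h i).2.1,
    Finset.mul_sum]
  exact Finset.sum_congr rfl fun i _ => (h i).2.2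

lemma js_cross {n : ℕ} (μ x : Fin n → ℝ) (c : ℝ) (hc : 0 < c) :
    |∑ j, μ j * x j| ≤ c / 2 + (∑ j, μ j ^ 2) / (2 * c) * ∑ j, x j ^ 2 := by
  have h := Finset.sum_mul_sq_le_sq_mul_sq Finset.univ μ x
  generalize ∑ j, μ j * x j = a at *
  have e : c / 2 + (∑ j, μ j ^ 2) / (2 * c) * ∑ j, x j ^ 2
    = (c ^ 2 + (∑ j, μ j ^ 2) * ∑ j, x j ^ 2) / (2 * c) := by field_simp
  rw [e, le_div_iff₀ (by positivity)]
  nlinarith [sq_nonneg (|a| - c), sq_abs a]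

lemma js_expand {n : ℕ} (μ x : Fin n → ℝ) :
    ∑ j, (x j - μ j) * x j = ∑ j, x j ^ 2 - ∑ j, μ j * x j := by
  rw [← Finset.sum_sub_distrib]; exact Finset.sum_congr rfl fun i _ => by ring

lemma js_ae_pos {n : ℕ} (μ : Fin (n + 1) → ℝ) (v : NNReal) (hv : v ≠ 0) :
    ∀ᵐ x ∂(Measure.pi fun i => gaussianReal (μ i) v), 0 < ∑ j, x j ^ 2 := by
  have : ∀ i, NullSingletonClass (gaussianReal (μ i) v) :=
    fun i => nullSingletonClass_gaussianReal hv
  have : ∀ᵐ x ∂(Measure.pi fun i => gaussianReal (μ i) v), x ≠ 0 := by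
    rw [ae_iff]; simp
  filter_upwards [this] with x hx
  obtain ⟨i, hi⟩ := Function.ne_iff.1 hx
  exact Finset.sum_pos' (fun j _ => sq_nonneg _) ⟨i, Finset.mem_univ i, by
    have : x i ≠ 0 := hi
    positivity⟩

lemma js_integrable_eps {n : ℕ} (μ : Fin (n + 1) → ℝ) (v : NNReal) (ε : ℝ) (hε : 0 < ε) :
    Integrable (fun x : Fin (n + 1) → ℝ => (∑ j, x j ^ 2 + ε)⁻¹)
      (Measure.pi fun i => gaussianReal (μ i) v) := by
  refine Integrable.of_bound (Measurable.aestronglyMeasurable (by fun_prop)) ε⁻¹ (ae_of_all _ fun x => ?_)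
  have : 0 ≤ ∑ j, x j ^ 2 := Finset.sum_nonneg fun j _ => sq_nonneg _
  rw [Real.norm_of_nonneg (by positivity)]
  exact inv_anti₀ hε (by linarith)

lemma js_bound {n : ℕ} (hn : 2 ≤ n) (μ : Fin (n + 1) → ℝ) (v : NNReal) (hv : v ≠ 0) (ε : ℝ)
    (hε : 0 < ε) :
    (v * (n - 1)) / 2 * ∫ x : Fin (n + 1) → ℝ, (∑ j, x j ^ 2 + ε)⁻¹
        ∂(Measure.pi fun i => gaussianReal (μ i) v)
      ≤ 1 + (∑ j, μ j ^ 2) / (2 * (v * (n - 1))) := by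
  have hn' : (2 : ℝ) ≤ n := by exact_mod_cast hn
  have hv' : (0 : ℝ) < v := by exact_mod_cast pos_iff_ne_zero.2 hv
  obtain ⟨i1, h1⟩ := js_eps μ v hv ε hε
  have i0 := js_integrable_eps μ v ε hε
  set c : ℝ := v * (n - 1) with hc
  have hc0 : 0 < c := mul_pos hv' (by linarith)
  have up : ∫ x : Fin (n + 1) → ℝ, (∑ j, (x j - μ j) * x j) / (∑ j, x j ^ 2 + ε)
        ∂(Measure.pi fun i => gaussianReal (μ i) v)
      ≤ ∫ x : Fin (n + 1) → ℝ, ((1 + (∑ j, μ j ^ 2) / (2 * c)) + c / 2 * (∑ j, x j ^ 2 + ε)⁻¹)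
        ∂(Measure.pi fun i => gaussianReal (μ i) v) := by
    refine integral_mono i1 ((integrable_const _).add (i0.const_mul _)) fun x => ?_
    have hS : 0 ≤ ∑ j, x j ^ 2 := Finset.sum_nonneg fun j _ => sq_nonneg _
    have hM : 0 ≤ (∑ j, μ j ^ 2) / (2 * c) :=
      div_nonneg (Finset.sum_nonneg fun j _ => sq_nonneg _) (by positivity)
    have hx := (abs_le.1 (js_cross μ x c hc0)).1
    simp only [js_expand]
    generalize ∑ j, x j ^ 2 = S at *
    generalize (∑ j, μ j ^ 2) / (2 * c) = M at *
    rw [div_le_iff₀ (by positivity), add_mul, mul_assoc, inv_mul_cancel₀ (by positivity)]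
    nlinarith
  have lo : (n - 1) * ∫ x : Fin (n + 1) → ℝ, (∑ j, x j ^ 2 + ε)⁻¹
        ∂(Measure.pi fun i => gaussianReal (μ i) v)
      ≤ ∫ x : Fin (n + 1) → ℝ, ((n + 1) / (∑ j, x j ^ 2 + ε)
        - 2 * (∑ j, x j ^ 2) / (∑ j, x j ^ 2 + ε) ^ 2)
        ∂(Measure.pi fun i => gaussianReal (μ i) v) := by
    rw [← integral_const_mul]
    refine integral_mono_of_nonneg (ae_of_all _ fun x => ?_) ?_ (ae_of_all _ fun x => ?_)
    · have hS : 0 ≤ ∑ j, x j ^ 2 := Finset.sum_nonneg fun j _ => sq_nonneg _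
      have : (0 : ℝ) ≤ n - 1 := by linarith
      simp only [Pi.zero_apply]
      positivity
    · refine (i0.const_mul (n + 3 : ℝ)).mono' (Measurable.aestronglyMeasurable (by fun_prop)) (ae_of_all _ fun x => ?_)
      have hS : 0 ≤ ∑ j, x j ^ 2 := Finset.sum_nonneg fun j _ => sq_nonneg _
      generalize ∑ j, x j ^ 2 = S at *
      refine (norm_sub_le _ _).trans ?_
      rw [Real.norm_of_nonneg (by positivity), Real.norm_of_nonneg (by positivity)]
      have h2 : 2 * S / (S + ε) ^ 2 ≤ 2 / (S + ε) := by
        rw [div_le_div_iff₀ (by positivity) (by positivity)]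
        nlinarith
      have : (n + 3 : ℝ) * (S + ε)⁻¹ = (n + 1) / (S + ε) + 2 / (S + ε) := by ring
      linarith
    · have hS : 0 ≤ ∑ j, x j ^ 2 := Finset.sum_nonneg fun j _ => sq_nonneg _
      simp only
      generalize ∑ j, x j ^ 2 = S at *
      have h2 : 2 * S / (S + ε) ^ 2 ≤ 2 / (S + ε) := by
        rw [div_le_div_iff₀ (by positivity) (by positivity)]
        nlinarith
      have : (n - 1 : ℝ) * (S + ε)⁻¹ = (n + 1) / (S + ε) - 2 / (S + ε) := by ring
      linarith
  rw [integral_add (integrable_const _) (i0.const_mul _), integral_const_mul] at up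
  simp only [integral_const, probReal_univ, one_smul] at up
  have := mul_le_mul_of_nonneg_left lo hv'.le
  rw [← mul_assoc, ← hc] at this
  linarith

lemma js_tendsto_inv (S : ℝ) (hS : 0 < S) :
    Tendsto (fun k : ℕ => (S + 1 / ((k : ℝ) + 1))⁻¹) atTop (nhds S⁻¹) := by
  have : Tendsto (fun k : ℕ => (S + 1 / ((k : ℝ) + 1))) atTop (nhds (S + 0)) :=
    tendsto_const_nhds.add tendsto_one_div_add_atTop_nhds_zero_nat
  rw [add_zero] at this
  exact this.inv₀ hS.ne'

lemma js_integrable_of_tendsto {α : Type*} [MeasurableSpace α] {G : ℕ → α → ℝ} {f : α → ℝ}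
    {μ : Measure α} (hGf : ∀ᵐ x ∂μ, Tendsto (fun n => G n x) atTop (nhds (f x)))
    (hG : ∀ n, AEStronglyMeasurable (G n) μ)
    (hG' : liminf (fun n => ∫⁻ x, ‖G n x‖ₑ ∂μ) atTop ≠ ⊤) : Integrable f μ :=
  ⟨aestronglyMeasurable_of_tendsto_ae _ hG hGf,
    lt_of_le_of_lt ((lintegral_congr_ae (by filter_upwards [hGf] with x hx using hx.enorm.liminf_eq)).symm.le.trans
      (lintegral_liminf_le' fun n => (hG n).aemeasurable.enorm)) hG'.lt_top⟩

lemma js_integrable_inv {n : ℕ} (hn : 2 ≤ n) (μ : Fin (n + 1) → ℝ) (v : NNReal) (hv : v ≠ 0) :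
    Integrable (fun x : Fin (n + 1) → ℝ => (∑ j, x j ^ 2)⁻¹)
      (Measure.pi fun i => gaussianReal (μ i) v) := by
  have hn' : (2 : ℝ) ≤ n := by exact_mod_cast hn
  have hv' : (0 : ℝ) < v := by exact_mod_cast pos_iff_ne_zero.2 hv
  have hc0 : 0 < (v : ℝ) * (n - 1) / 2 := by
    have : (0 : ℝ) < n - 1 := by linarith
    positivity
  refine js_integrable_of_tendsto
    (G := fun (k : ℕ) (x : Fin (n + 1) → ℝ) => (∑ j, x j ^ 2 + 1 / ((k : ℝ) + 1))⁻¹)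
    ?_ (fun k => Measurable.aestronglyMeasurable (by fun_prop)) ?_
  · filter_upwards [js_ae_pos μ v hv] with x hx using js_tendsto_inv _ hx
  · refine ne_top_of_le_ne_top (b := ENNReal.ofReal
      ((1 + (∑ j, μ j ^ 2) / (2 * (v * (n - 1)))) / ((v : ℝ) * (n - 1) / 2)))
      ENNReal.ofReal_ne_top ?_
    refine (liminf_le_liminf (v := fun _ => ENNReal.ofReal
      ((1 + (∑ j, μ j ^ 2) / (2 * (v * (n - 1)))) / ((v : ℝ) * (n - 1) / 2)))
      (Eventually.of_forall fun k => ?_)).trans (by simp)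
    have hk : (0 : ℝ) < 1 / ((k : ℝ) + 1) := by positivity
    rw [← ofReal_integral_norm_eq_lintegral_enorm (js_integrable_eps μ v _ hk)]
    refine ENNReal.ofReal_le_ofReal ?_
    rw [le_div_iff₀ hc0]
    refine le_trans (le_of_eq ?_) (js_bound hn μ v hv _ hk)
    rw [mul_comm]
    congr 2
    ext x
    have hS : 0 ≤ ∑ j, x j ^ 2 := Finset.sum_nonneg fun j _ => sq_nonneg _
    rw [Real.norm_of_nonneg (by positivity)]

lemma js_stein_final {n : ℕ} (hn : 2 ≤ n) (μ : Fin (n + 1) → ℝ) (v : NNReal) (hv : v ≠ 0) :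
    Integrable (fun x : Fin (n + 1) → ℝ => (∑ j, (x j - μ j) * x j) * (∑ j, x j ^ 2)⁻¹)
      (Measure.pi fun i => gaussianReal (μ i) v) ∧
    ∫ x : Fin (n + 1) → ℝ, (∑ j, (x j - μ j) * x j) * (∑ j, x j ^ 2)⁻¹
        ∂(Measure.pi fun i => gaussianReal (μ i) v)
      = v * ((n - 1) * ∫ x : Fin (n + 1) → ℝ, (∑ j, x j ^ 2)⁻¹
        ∂(Measure.pi fun i => gaussianReal (μ i) v)) := by
  have ii := js_integrable_inv hn μ v hv
  have ib : Integrable (fun x : Fin (n + 1) → ℝ =>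
      (1 + (∑ j, μ j ^ 2) / (2 * 1)) + 1 / 2 * (∑ j, x j ^ 2)⁻¹)
      (Measure.pi fun i => gaussianReal (μ i) v) := (integrable_const _).add (ii.const_mul _)
  have hM : 0 ≤ (∑ j, μ j ^ 2) / (2 * 1) :=
      div_nonneg (Finset.sum_nonneg fun j _ => sq_nonneg _) (by positivity)
  have hbd : ∀ x : Fin (n + 1) → ℝ, 0 < ∑ j, x j ^ 2 → ∀ ε : ℝ, 0 ≤ ε →
      ‖(∑ j, (x j - μ j) * x j) / (∑ j, x j ^ 2 + ε)‖
        ≤ (1 + (∑ j, μ j ^ 2) / (2 * 1)) + 1 / 2 * (∑ j, x j ^ 2)⁻¹ := by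
    intro x hS ε hε
    have hx := (abs_le.1 (js_cross μ x 1 one_pos))
    rw [js_expand, Real.norm_eq_abs, abs_div]
    generalize ∑ j, x j ^ 2 = S at *
    generalize (∑ j, μ j ^ 2) / (2 * 1) = M at *
    rw [abs_of_pos (by positivity : 0 < S + ε)]
    refine (div_le_div_of_nonneg_left (abs_nonneg _) hS (by linarith : S ≤ S + ε)).trans ?_
    rw [div_le_iff₀ hS, add_mul, mul_assoc, inv_mul_cancel₀ hS.ne', abs_le]
    constructor <;> nlinarith [hx.1, hx.2]
  refine ⟨ib.mono' (Measurable.aestronglyMeasurable (by fun_prop)) ?_, ?_⟩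
  · filter_upwards [js_ae_pos μ v hv] with x hx
    simpa [div_eq_mul_inv] using hbd x hx 0 le_rfl
  · have t1 := tendsto_integral_of_dominated_convergence (μ := Measure.pi fun i => gaussianReal (μ i) v)
      (F := fun (k : ℕ) (x : Fin (n + 1) → ℝ) =>
        (∑ j, (x j - μ j) * x j) / (∑ j, x j ^ 2 + 1 / ((k : ℝ) + 1)))
      (f := fun x => (∑ j, (x j - μ j) * x j) * (∑ j, x j ^ 2)⁻¹)
      _ (fun k => Measurable.aestronglyMeasurable (by fun_prop)) ib
      (fun k => by filter_upwards [js_ae_pos μ v hv] with x hx using hbd x hx _ (by positivity))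
      (by
        filter_upwards [js_ae_pos μ v hv] with x hx
        simp_rw [div_eq_mul_inv (∑ j, (x j - μ j) * x j)]
        exact (js_tendsto_inv _ hx).const_mul _)
    have t2 := tendsto_integral_of_dominated_convergence (μ := Measure.pi fun i => gaussianReal (μ i) v)
      (F := fun (k : ℕ) (x : Fin (n + 1) → ℝ) => ((n + 1) / (∑ j, x j ^ 2 + 1 / ((k : ℝ) + 1))
        - 2 * (∑ j, x j ^ 2) / (∑ j, x j ^ 2 + 1 / ((k : ℝ) + 1)) ^ 2))
      (f := fun x => (n - 1) * (∑ j, x j ^ 2)⁻¹)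
      (fun x => (n + 3) * (∑ j, x j ^ 2)⁻¹) (fun k => Measurable.aestronglyMeasurable (by fun_prop)) (ii.const_mul _)
      (fun k => by
        filter_upwards [js_ae_pos μ v hv] with x hS
        have hk : (0 : ℝ) < 1 / ((k : ℝ) + 1) := by positivity
        generalize 1 / ((k : ℝ) + 1) = ε at *
        generalize ∑ j, x j ^ 2 = S at *
        refine (norm_sub_le _ _).trans ?_
        rw [Real.norm_of_nonneg (by positivity), Real.norm_of_nonneg (by positivity)]
        have h2 : 2 * S / (S + ε) ^ 2 ≤ 2 / (S + ε) := by
          rw [div_le_div_iff₀ (by positivity) (by positivity)]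
          nlinarith
        have : (n + 3 : ℝ) * (S + ε)⁻¹ = (n + 1) / (S + ε) + 2 / (S + ε) := by ring
        have h3 : (n + 3 : ℝ) * (S + ε)⁻¹ ≤ (n + 3 : ℝ) * S⁻¹ := by
          gcongr
          linarith
        linarith)
      (by
        filter_upwards [js_ae_pos μ v hv] with x hx
        have h := js_tendsto_inv _ hx
        have := (h.const_mul (n + 1 : ℝ)).sub ((h.pow 2).const_mul (2 * (∑ j, x j ^ 2)))
        convert this using 2
        · rw [inv_pow, ← div_eq_mul_inv, ← div_eq_mul_inv]
        · field_simp; ring)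
    have t3 := t2.const_mul (v : ℝ)
    rw [← integral_const_mul (n - 1 : ℝ)]
    refine tendsto_nhds_unique t1 (t3.congr fun k => ?_)
    exact (js_eps μ v hv _ (by positivity)).2.symm

lemma js_var_coord (m : ℝ) (v : NNReal) : Integrable (fun x => (x - m) ^ 2) (gaussianReal m v) ∧
    ∫ x, (x - m) ^ 2 ∂(gaussianReal m v) = v := by
  constructor
  · exact ((memLp_id_gaussianReal (μ := m) (v := v) 2).sub (memLp_const m)).integrable_sq
  · have := variance_fun_id_gaussianReal (μ := m) (v := v)
    rw [variance_eq_integral (by fun_prop)] at this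
    simpa using this

lemma js_var {n : ℕ} (μ : Fin n → ℝ) (v : NNReal) :
    Integrable (fun x : Fin n → ℝ => ∑ i, (x i - μ i) ^ 2)
      (Measure.pi fun i => gaussianReal (μ i) v) ∧
    ∫ x : Fin n → ℝ, ∑ i, (x i - μ i) ^ 2 ∂(Measure.pi fun i => gaussianReal (μ i) v) = n * v := by
  have h := fun i => js_var_coord (μ i) v
  have mp := fun i => measurePreserving_eval (fun i => gaussianReal (μ i) v) i
  have hi : ∀ i, Integrable (fun x : Fin n → ℝ => (x i - μ i) ^ 2)
      (Measure.pi fun i => gaussianReal (μ i) v) :=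
    fun i => (mp i).integrable_comp_of_integrable (h i).1
  refine ⟨integrable_finsetSum _ fun i _ => hi i, ?_⟩
  rw [integral_finsetSum _ fun i _ => hi i]
  have : ∀ i, ∫ x : Fin n → ℝ, (x i - μ i) ^ 2 ∂(Measure.pi fun i => gaussianReal (μ i) v) = v := by
    intro i
    rw [← (h i).2, ← (mp i).map_eq, integral_map (mp i).aemeasurable (by fun_prop)]
  simp [this]

/-- James–Stein dominance: for p ≥ 3 the James–Stein estimator has strictly
smaller mean squared error than the maximum likelihood estimator X. -/
theorem james_stein_dominance
    {Ω : Type*} [MeasureSpace Ω] [IsProbabilityMeasure (ℙ : Measure Ω)]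
    (p : ℕ) (hp : 3 ≤ p) (μ : Fin p → ℝ) (σ : ℝ) (hσ : 0 < σ)
    (X : Ω → Fin p → ℝ) (hX : Measurable X)
    (hlaw : Measure.map X ℙ = Measure.pi fun i => gaussianReal (μ i) (Real.toNNReal (σ ^ 2))) :
    Integrable (fun ω => (∑ i, X ω i ^ 2)⁻¹) ℙ ∧
    ((∫ ω, (∑ i, ((1 - ((p : ℝ) - 2) * σ ^ 2 / (∑ j, X ω j ^ 2)) * X ω i - μ i) ^ 2) ∂ℙ) =
      (p : ℝ) * σ ^ 2 - ((p : ℝ) - 2) ^ 2 * σ ^ 4 * (∫ ω, (∑ i, X ω i ^ 2)⁻¹ ∂ℙ)) ∧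
    ((∫ ω, (∑ i, ((1 - ((p : ℝ) - 2) * σ ^ 2 / (∑ j, X ω j ^ 2)) * X ω i - μ i) ^ 2) ∂ℙ) <
      (p : ℝ) * σ ^ 2) ∧
    (p : ℝ) * σ ^ 2 = ∫ ω, (∑ i, (X ω i - μ i) ^ 2) ∂ℙ := by
  obtain ⟨n, rfl⟩ : ∃ n, p = n + 1 := ⟨p - 1, by omega⟩
  have hn : 2 ≤ n := by omega
  have hn' : (2 : ℝ) ≤ n := by exact_mod_cast hn
  have hv : Real.toNNReal (σ ^ 2) ≠ 0 := by
    have : 0 < Real.toNNReal (σ ^ 2) := Real.toNNReal_pos.2 (by positivity)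
    exact this.ne'
  have hvσ : ((Real.toNNReal (σ ^ 2) : NNReal) : ℝ) = σ ^ 2 := Real.coe_toNNReal _ (by positivity)
  have mp : MeasurePreserving X ℙ
    (Measure.pi fun i => gaussianReal (μ i) (Real.toNNReal (σ ^ 2))) := ⟨hX, hlaw⟩
  have tr : ∀ f : (Fin (n + 1) → ℝ) → ℝ, Measurable f → ∫ ω, f (X ω) ∂ℙ
      = ∫ x, f x ∂(Measure.pi fun i => gaussianReal (μ i) (Real.toNNReal (σ ^ 2))) := by
    intro f hf
    rw [← hlaw, integral_map hX.aemeasurable hf.aestronglyMeasurable]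
  have ii := js_integrable_inv hn μ _ hv
  obtain ⟨i2, h2⟩ := js_stein_final hn μ _ hv
  obtain ⟨i3, h3⟩ := js_var μ (Real.toNNReal (σ ^ 2))
  have hpos := js_ae_pos μ _ hv
  rw [hvσ] at h2 h3
  rw [tr (fun x => (∑ i, x i ^ 2)⁻¹) (by fun_prop),
    tr (fun x => ∑ i, ((1 - (((n + 1 : ℕ) : ℝ) - 2) * σ ^ 2 / (∑ j, x j ^ 2)) * x i - μ i) ^ 2)
      (by fun_prop),
    tr (fun x => ∑ i, (x i - μ i) ^ 2) (by fun_prop), h3]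
  generalize hν : (Measure.pi fun i => gaussianReal (μ i) (Real.toNNReal (σ ^ 2))) = ν at *
  have main : ∫ x, ∑ i, ((1 - (((n + 1 : ℕ) : ℝ) - 2) * σ ^ 2 / (∑ j, x j ^ 2)) * x i - μ i) ^ 2 ∂ν
      = ((n + 1 : ℕ) : ℝ) * σ ^ 2
        - (((n + 1 : ℕ) : ℝ) - 2) ^ 2 * σ ^ 4 * ∫ x, (∑ i, x i ^ 2)⁻¹ ∂ν := by
    set c : ℝ := (((n + 1 : ℕ) : ℝ) - 2) * σ ^ 2 with hc
    have e : ∫ x, ∑ i, ((1 - c / (∑ j, x j ^ 2)) * x i - μ i) ^ 2 ∂ν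
        = ∫ x, ((∑ i, (x i - μ i) ^ 2 - 2 * c * ((∑ j, (x j - μ j) * x j) * (∑ j, x j ^ 2)⁻¹))
          + c ^ 2 * (∑ j, x j ^ 2)⁻¹) ∂ν := by
      refine integral_congr_ae ?_
      filter_upwards [hpos] with x hx
      have e1 : c ^ 2 * (∑ j, x j ^ 2)⁻¹ = (c / ∑ j, x j ^ 2) ^ 2 * ∑ j, x j ^ 2 := by
        field_simp
      have e2 : 2 * c * ((∑ j, (x j - μ j) * x j) * (∑ j, x j ^ 2)⁻¹)
        = 2 * (c / ∑ j, x j ^ 2) * (∑ j, (x j - μ j) * x j) := by ring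
      rw [e1, e2]
      generalize c / ∑ j, x j ^ 2 = d
      rw [Finset.mul_sum, Finset.mul_sum, ← Finset.sum_sub_distrib, ← Finset.sum_add_distrib]
      exact Finset.sum_congr rfl fun i _ => by ring
    have i4 : Integrable (fun x => ∑ i, (x i - μ i) ^ 2
        - 2 * c * ((∑ j, (x j - μ j) * x j) * (∑ j, x j ^ 2)⁻¹)) ν := i3.sub (i2.const_mul _)
    rw [e, integral_add i4 (ii.const_mul _),
      integral_sub i3 (i2.const_mul _), integral_const_mul, integral_const_mul, h2, h3, hc]
    push_cast
    ring
  have ipos : 0 < ∫ x, (∑ i, x i ^ 2)⁻¹ ∂ν := by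
    have : IsProbabilityMeasure ν := by rw [← hν]; infer_instance
    have h0 : 0 ≤ᵐ[ν] fun x => (∑ i, x i ^ 2)⁻¹ := by
      filter_upwards [hpos] with x hx using (inv_pos.2 hx).le
    refine lt_of_le_of_ne (integral_nonneg_of_ae h0) fun h => ?_
    have h' := (integral_eq_zero_iff_of_nonneg_ae h0 ii).1 h.symm
    have : ∀ᵐ x ∂ν, False := by
      filter_upwards [hpos, h'] with x hx hx'
      exact (inv_pos.2 hx).ne' hx'
    simp at this
    exact IsProbabilityMeasure.ne_zero ν this
  refine ⟨mp.integrable_comp_of_integrable ii, main, ?_, rfl⟩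
  rw [main]
  have : (0 : ℝ) < ((n + 1 : ℕ) : ℝ) - 2 := by push_cast; linarith
  have := mul_pos (mul_pos (pow_pos this 2) (pow_pos hσ 4)) ipos
  linarith
end
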